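/- Suppose (Ω₁,u₁),…,(Ω_k,u_k) is a family of disjointly supported minimal graphs in ℝ³ (pairwise disjoint open sets Ω_i ⊆ ℝ², each u_i a nonnegative, not identically zero smooth solution of the minimal surface equation vanishing continuously on ∂Ω_i). If the gradients decay at infinity, i.e. |∇u_i(x)| → 0 as |x| → ∞ in Ω_i for each i, then k ≤ 2. -/

import Mathlib

open Real MeasureTheory ENNReal

noncomputable section

abbrev E2 := EuclideanSpace ℝ (Fin 2)

/-- The divergence of the vector field `∇u/√(1+|∇u|²)` at the point `x`;
the minimal surface equation asserts that this vanishes. -/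
def msDiv (u : E2 → ℝ) (x : E2) : ℝ :=
  ∑ i : Fin 2, fderiv ℝ (fun y => (Real.sqrt (1 + ‖gradient u y‖ ^ 2))⁻¹ * gradient u y i) x
    (EuclideanSpace.single i 1)

theorem sq_integral_mul_le {f g : ℝ → ℝ} {a b : ℝ} (hab : a ≤ b)
    (hff : IntervalIntegrable (fun x => f x ^ 2) volume a b)
    (hfg : IntervalIntegrable (fun x => f x * g x) volume a b)
    (hgg : IntervalIntegrable (fun x => g x ^ 2) volume a b) :
    (∫ x in a..b, f x * g x) ^ 2 ≤ (∫ x in a..b, f x ^ 2) * ∫ x in a..b, g x ^ 2 := by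
  have key : ∀ c : ℝ, 0 ≤ (∫ x in a..b, f x ^ 2) * (c * c)
      + 2 * (∫ x in a..b, f x * g x) * c + ∫ x in a..b, g x ^ 2 := by
    intro c
    have h : 0 ≤ ∫ x in a..b, (c * f x + g x) ^ 2 :=
      intervalIntegral.integral_nonneg hab fun x _ => sq_nonneg _
    have e : ∀ x, (c * f x + g x) ^ 2
        = (c * c) * f x ^ 2 + (2 * c) * (f x * g x) + g x ^ 2 := fun x => by ring
    simp only [e] at h
    rw [intervalIntegral.integral_add ((hff.const_mul _).add (hfg.const_mul _)) hgg,
      intervalIntegral.integral_add (hff.const_mul _) (hfg.const_mul _),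
      intervalIntegral.integral_const_mul, intervalIntegral.integral_const_mul] at h
    linarith
  have := discrim_le_zero key
  rw [discrim] at this
  nlinarith

theorem integral_mul_primitive {h : ℝ → ℝ} {a b : ℝ} (hh : IntervalIntegrable h volume a b) :
    ∫ x in a..b, h x * ∫ y in a..x, h y = (∫ y in a..b, h y) ^ 2 / 2 := by
  have hac := hh.absolutelyContinuousOnInterval_intervalIntegral (c := a) (by simp)
  have e := AbsolutelyContinuousOnInterval.integral_deriv_mul_eq_sub hac hac
  have e2 : ∫ x in a..b, (deriv (fun x => ∫ y in a..x, h y) x * (∫ y in a..x, h y)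
      + (∫ y in a..x, h y) * deriv (fun x => ∫ y in a..x, h y) x)
      = ∫ x in a..b, 2 * (h x * ∫ y in a..x, h y) := by
    apply intervalIntegral.integral_congr_ae
    filter_upwards [hh.ae_hasDerivAt_integral] with x hx hx'
    rw [(hx (Set.uIoc_subset_uIcc hx') a (by simp)).deriv]
    ring
  rw [e2, intervalIntegral.integral_const_mul] at e
  simp only [intervalIntegral.integral_same] at e
  linarith

/-- The indicator function of the positivity set of `f`. -/
def posInd (f : ℝ → ℝ) (x : ℝ) : ℝ := {y | 0 < f y}.indicator (fun _ => 1) x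

theorem posInd_of_pos {f : ℝ → ℝ} {x : ℝ} (h : 0 < f x) : posInd f x = 1 :=
  Set.indicator_of_mem (s := {y | 0 < f y}) h _

theorem posInd_of_not_pos {f : ℝ → ℝ} {x : ℝ} (h : ¬ 0 < f x) : posInd f x = 0 :=
  Set.indicator_of_notMem (s := {y | 0 < f y}) h _

theorem posInd_nonneg (f : ℝ → ℝ) (x : ℝ) : 0 ≤ posInd f x := by
  by_cases h : 0 < f x
  · simp [posInd_of_pos h]
  · simp [posInd_of_not_pos h]

theorem posInd_sq (f : ℝ → ℝ) (x : ℝ) : posInd f x ^ 2 = posInd f x := by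
  by_cases h : 0 < f x
  · simp [posInd_of_pos h]
  · simp [posInd_of_not_pos h]

theorem intervalIntegrable_posInd_mul {f g : ℝ → ℝ} (hf : Continuous f) (hg : Continuous g)
    (a b : ℝ) : IntervalIntegrable (fun x => posInd f x * g x) volume a b := by
  have hm : MeasurableSet {y | 0 < f y} := (isOpen_lt continuous_const hf).measurableSet
  have e : (fun x => posInd f x * g x) = {y | 0 < f y}.indicator g := by
    ext x
    by_cases h : 0 < f x
    · rw [posInd_of_pos h, Set.indicator_of_mem (s := {y | 0 < f y}) h, one_mul]
    · rw [posInd_of_not_pos h, Set.indicator_of_notMem (s := {y | 0 < f y}) h, zero_mul]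
  rw [e, intervalIntegrable_iff]
  exact (intervalIntegrable_iff.1 (hg.intervalIntegrable a b)).indicator hm

theorem intervalIntegrable_posInd {f : ℝ → ℝ} (hf : Continuous f) (a b : ℝ) :
    IntervalIntegrable (posInd f) volume a b := by
  simpa using intervalIntegrable_posInd_mul hf (continuous_const (y := (1 : ℝ))) a b

theorem wirtinger_half {f f' : ℝ → ℝ} (hd : ∀ x, HasDerivAt f (f' x) x) (hc : Continuous f')
    (h0 : ∀ x, 0 ≤ f x) {a c : ℝ} (hac : a ≤ c) (hfa : f a = 0) :
    ∫ x in a..c, f x ^ 2 ≤ (∫ x in a..c, posInd f x) ^ 2 / 2 * ∫ x in a..c, f' x ^ 2 := by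
  have hfc : Continuous f := continuous_iff_continuousAt.2 fun x => (hd x).continuousAt
  have hf'0 : ∀ x, posInd f x * f' x = f' x := by
    intro x
    by_cases h : 0 < f x
    · rw [posInd_of_pos h, one_mul]
    · have hx : f x = 0 := le_antisymm (not_lt.1 h) (h0 x)
      have hmin : IsLocalMin f x := Filter.Eventually.of_forall fun y => by rw [hx]; exact h0 y
      rw [hmin.hasDerivAt_eq_zero (hd x), mul_zero]
  have hii := fun p q => intervalIntegrable_posInd hfc p q
  have hprim : Continuous fun x => ∫ y in a..x, posInd f y :=
    intervalIntegral.continuous_primitive hii a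
  have hpt : ∀ x ∈ Set.Icc a c, f x ^ 2 ≤ (∫ y in a..c, f' y ^ 2) *
      (posInd f x * ∫ y in a..x, posInd f y) := by
    intro x hx
    by_cases h : 0 < f x
    · have e : f x = ∫ y in a..x, posInd f y * f' y := by
        simp only [hf'0]
        rw [intervalIntegral.integral_eq_sub_of_hasDerivAt (fun y _ => hd y)
          (hc.intervalIntegrable _ _), hfa, sub_zero]
      have cs := sq_integral_mul_le (f := posInd f) (g := f') hx.1
        (by simpa only [posInd_sq] using hii a x) (intervalIntegrable_posInd_mul hfc hc _ _)
        ((hc.pow 2).intervalIntegrable _ _)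
      rw [← e] at cs
      simp only [posInd_sq] at cs
      have hm : ∫ y in a..x, f' y ^ 2 ≤ ∫ y in a..c, f' y ^ 2 :=
        intervalIntegral.integral_mono_interval le_rfl hx.1 hx.2
          (Filter.Eventually.of_forall fun y => sq_nonneg _) ((hc.pow 2).intervalIntegrable _ _)
      have hn : 0 ≤ ∫ y in a..x, posInd f y :=
        intervalIntegral.integral_nonneg hx.1 fun y _ => posInd_nonneg f y
      rw [posInd_of_pos h, one_mul]
      nlinarith
    · have hx : f x = 0 := le_antisymm (not_lt.1 h) (h0 x)
      rw [hx, posInd_of_not_pos h]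
      simp
  calc ∫ x in a..c, f x ^ 2
      ≤ ∫ x in a..c, (∫ y in a..c, f' y ^ 2) * (posInd f x * ∫ y in a..x, posInd f y) :=
        intervalIntegral.integral_mono_on hac ((hfc.pow 2).intervalIntegrable _ _)
          ((intervalIntegrable_posInd_mul hfc hprim _ _).const_mul _) hpt
    _ = _ := by
        rw [intervalIntegral.integral_const_mul, integral_mul_primitive (hii a c)]
        ring

theorem wirtinger {f f' : ℝ → ℝ} (hd : ∀ x, HasDerivAt f (f' x) x) (hc : Continuous f')
    (h0 : ∀ x, 0 ≤ f x) {a b : ℝ} (hab : a ≤ b) (hfa : f a = 0) (hfb : f b = 0) :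
    ∫ x in a..b, f x ^ 2 ≤ (∫ x in a..b, posInd f x) ^ 2 / 8 * ∫ x in a..b, f' x ^ 2 := by
  have hfc : Continuous f := continuous_iff_continuousAt.2 fun x => (hd x).continuousAt
  have hii := fun p q => intervalIntegrable_posInd hfc p q
  have hprim : Continuous fun x => ∫ y in a..x, posInd f y :=
    intervalIntegral.continuous_primitive hii a
  have hn : 0 ≤ ∫ y in a..b, posInd f y :=
    intervalIntegral.integral_nonneg hab fun y _ => posInd_nonneg f y
  obtain ⟨c, hcI, hcm⟩ : ∃ c ∈ Set.Icc a b,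
      ∫ y in a..c, posInd f y = (∫ y in a..b, posInd f y) / 2 := by
    have := intermediate_value_Icc hab hprim.continuousOn
    apply this
    simp only [intervalIntegral.integral_same]
    constructor <;> linarith
  have hl := wirtinger_half hd hc h0 hcI.1 hfa
  have hr := wirtinger_half (f := fun x => f (-x)) (f' := fun x => -f' (-x))
    (fun x => by simpa [Function.comp_def] using (hd (-x)).scomp x (hasDerivAt_neg x)) (by fun_prop)
    (fun x => h0 _) (neg_le_neg hcI.2) (by simpa using hfb)
  have ep : ∀ x, posInd (fun x => f (-x)) x = posInd f (-x) := fun x => rfl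
  simp only [ep, neg_sq] at hr
  rw [intervalIntegral.integral_comp_neg (fun x => f x ^ 2),
    intervalIntegral.integral_comp_neg (fun x => f' x ^ 2),
    intervalIntegral.integral_comp_neg (fun x => posInd f x)] at hr
  simp only [neg_neg] at hr
  have s1 := intervalIntegral.integral_add_adjacent_intervals (hii a c) (hii c b)
  have i2 : ∀ p q, IntervalIntegrable (fun x => f x ^ 2) volume p q :=
    fun p q => (hfc.pow 2).intervalIntegrable _ _
  have i3 : ∀ p q, IntervalIntegrable (fun x => f' x ^ 2) volume p q :=
    fun p q => (hc.pow 2).intervalIntegrable _ _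
  have s2 := intervalIntegral.integral_add_adjacent_intervals (i2 a c) (i2 c b)
  have s3 := intervalIntegral.integral_add_adjacent_intervals (i3 a c) (i3 c b)
  have hcm' : ∫ y in c..b, posInd f y = (∫ y in a..b, posInd f y) / 2 := by linarith
  rw [hcm] at hl
  rw [hcm'] at hr
  rw [← s2, ← s3]
  nlinarith

theorem wirtinger_periodic {f f' : ℝ → ℝ} (hd : ∀ x, HasDerivAt f (f' x) x) (hc : Continuous f')
    (h0 : ∀ x, 0 ≤ f x) {T : ℝ} (hT : 0 ≤ T) (hp : Function.Periodic f T)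
    (hp' : Function.Periodic f' T) {a : ℝ} (ha : f a = 0) :
    ∫ x in 0..T, f x ^ 2 ≤ (∫ x in 0..T, posInd f x) ^ 2 / 8 * ∫ x in 0..T, f' x ^ 2 := by
  have h := wirtinger hd hc h0 (a := a) (b := a + T) (by linarith) ha (by rw [hp a, ha])
  have e : ∀ g : ℝ → ℝ, Function.Periodic g T → ∫ x in a..a + T, g x = ∫ x in 0..T, g x := by
    intro g hg
    simpa using hg.intervalIntegral_add_eq a 0
  rwa [e (fun x => f x ^ 2) (fun x => by simp only [hp x]),
    e (fun x => f' x ^ 2) (fun x => by simp only [hp' x]),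
    e (posInd f) (fun x => by
      by_cases h : 0 < f x
      · rw [posInd_of_pos h, posInd_of_pos (by rwa [hp x])]
      · rw [posInd_of_not_pos h, posInd_of_not_pos (by rwa [hp x])])] at h

/-- The partial derivative of `f` at `x` in the `i`-th coordinate direction. -/
def pderiv (f : E2 → ℝ) (i : Fin 2) (x : E2) : ℝ := fderiv ℝ f x (EuclideanSpace.single i 1)

/-- The point with logarithmic polar coordinates `(t, θ)`. -/
def pol (t θ : ℝ) : E2 :=
  (exp t * cos θ) • EuclideanSpace.single 0 1 + (exp t * sin θ) • EuclideanSpace.single 1 1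

/-- The image of `pol t θ` under the rotation by a right angle. -/
def polPerp (t θ : ℝ) : E2 :=
  (-(exp t * sin θ)) • EuclideanSpace.single 0 1 + (exp t * cos θ) • EuclideanSpace.single 1 1

theorem continuous_pol : Continuous fun p : ℝ × ℝ => pol p.1 p.2 := by
  unfold pol; fun_prop

theorem continuous_pol_right (t : ℝ) : Continuous (pol t) := by
  unfold pol; fun_prop

theorem hasDerivAt_pol_left (t θ : ℝ) : HasDerivAt (fun t => pol t θ) (pol t θ) t :=
  (((Real.hasDerivAt_exp t).mul_const _).smul_const _).add
    (((Real.hasDerivAt_exp t).mul_const _).smul_const _)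

theorem hasDerivAt_pol_right (t θ : ℝ) : HasDerivAt (pol t) (polPerp t θ) θ := by
  have h := (((Real.hasDerivAt_cos θ).const_mul (exp t)).smul_const
    (EuclideanSpace.single 0 1 : E2)).add
    (((Real.hasDerivAt_sin θ).const_mul (exp t)).smul_const (EuclideanSpace.single 1 1 : E2))
  rw [polPerp, ← mul_neg]
  exact h

theorem pol_periodic (t : ℝ) : Function.Periodic (pol t) (2 * π) := fun θ => by
  simp [pol]

theorem norm_pol (t θ : ℝ) : ‖pol t θ‖ = exp t := by
  rw [EuclideanSpace.norm_eq, Fin.sum_univ_two]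
  simp only [pol, PiLp.add_apply, PiLp.smul_apply, PiLp.single_apply]
  simp only [Fin.isValue, if_true, one_ne_zero, zero_ne_one, if_false, smul_eq_mul, mul_one,
    mul_zero, add_zero, zero_add, Real.norm_eq_abs, sq_abs]
  rw [show (exp t * cos θ) ^ 2 + (exp t * sin θ) ^ 2 = exp t ^ 2 by
    linear_combination exp t ^ 2 * Real.sin_sq_add_cos_sq θ]
  exact Real.sqrt_sq (exp_pos t).le

theorem exists_pol_eq {x : E2} (hx : x ≠ 0) : ∃ t θ, pol t θ = x := by
  let z : ℂ := ⟨x 0, x 1⟩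
  have hz0 : z ≠ 0 := by
    intro h
    apply hx
    have h0 : x 0 = 0 := congrArg Complex.re h
    have h1 : x 1 = 0 := congrArg Complex.im h
    ext i
    fin_cases i
    · simpa using h0
    · simpa using h1
  refine ⟨Real.log ‖z‖, z.arg, ?_⟩
  have hn := norm_pos_iff.2 hz0
  ext i
  fin_cases i
  · simp [pol, Real.exp_log hn, show z.re = x 0 from rfl]
  · simp [pol, Real.exp_log hn, show z.im = x 1 from rfl]

theorem fderiv_pol (f : E2 → ℝ) (x : E2) (t θ : ℝ) :
    fderiv ℝ f x (pol t θ) = exp t * (cos θ * pderiv f 0 x + sin θ * pderiv f 1 x) := by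
  simp only [pol, pderiv, map_add, map_smul, smul_eq_mul]
  ring

theorem fderiv_polPerp (f : E2 → ℝ) (x : E2) (t θ : ℝ) :
    fderiv ℝ f x (polPerp t θ) = exp t * (cos θ * pderiv f 1 x - sin θ * pderiv f 0 x) := by
  simp only [polPerp, pderiv, map_add, map_smul, smul_eq_mul]
  ring

theorem continuous_pderiv {f : E2 → ℝ} (hf : ContDiff ℝ 1 f) (i : Fin 2) :
    Continuous (pderiv f i) :=
  (hf.continuous_fderiv one_ne_zero).clm_apply continuous_const

theorem hasDerivAt_comp_pol_left {f : E2 → ℝ} (hf : ContDiff ℝ 1 f) (t θ : ℝ) :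
    HasDerivAt (fun t => f (pol t θ))
      (exp t * (cos θ * pderiv f 0 (pol t θ) + sin θ * pderiv f 1 (pol t θ))) t := by
  rw [← fderiv_pol]
  exact ((hf.differentiable one_ne_zero) _).hasFDerivAt.comp_hasDerivAt t (hasDerivAt_pol_left t θ)

theorem hasDerivAt_comp_pol_right {f : E2 → ℝ} (hf : ContDiff ℝ 1 f) (t θ : ℝ) :
    HasDerivAt (fun θ => f (pol t θ))
      (exp t * (cos θ * pderiv f 1 (pol t θ) - sin θ * pderiv f 0 (pol t θ))) θ := by
  rw [← fderiv_polPerp]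
  exact ((hf.differentiable one_ne_zero) _).hasFDerivAt.comp_hasDerivAt θ (hasDerivAt_pol_right t θ)

/-- The flux of the vector field `(H 0, H 1)` through the circle of radius `exp t`. -/
def flux (H : Fin 2 → E2 → ℝ) (t : ℝ) : ℝ :=
  ∫ θ in 0..2 * π, exp t * (cos θ * H 0 (pol t θ) + sin θ * H 1 (pol t θ))

theorem hasDerivAt_flux {H : Fin 2 → E2 → ℝ} (hH : ∀ i, ContDiff ℝ 1 (H i)) (t : ℝ) :
    HasDerivAt (flux H)
      (∫ θ in 0..2 * π, exp t ^ 2 * (pderiv (H 0) 0 (pol t θ) + pderiv (H 1) 1 (pol t θ))) t := by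
  have hc := fun i => (hH i).continuous
  have hpd := fun i j => continuous_pderiv (hH i) j
  have hpol := continuous_pol
  have hpolr := continuous_pol_right
  let F' : ℝ → ℝ → ℝ := fun t θ =>
    exp t * (cos θ * H 0 (pol t θ) + sin θ * H 1 (pol t θ)) + exp t *
      (cos θ * (exp t * (cos θ * pderiv (H 0) 0 (pol t θ) + sin θ * pderiv (H 0) 1 (pol t θ)))
      + sin θ * (exp t * (cos θ * pderiv (H 1) 0 (pol t θ) + sin θ * pderiv (H 1) 1 (pol t θ))))
  have hF'c : Continuous fun p : ℝ × ℝ => F' p.1 p.2 := by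
    have a1 := fun i => (hc i).comp hpol
    have a2 := fun i j => (hpd i j).comp hpol
    simp only [Function.comp_def] at a1 a2
    fun_prop
  have hF : ∀ t θ, HasDerivAt (fun t => exp t * (cos θ * H 0 (pol t θ) + sin θ * H 1 (pol t θ)))
      (F' t θ) t := fun t θ =>
    (Real.hasDerivAt_exp t).mul (((hasDerivAt_comp_pol_left (hH 0) t θ).const_mul _).add
      ((hasDerivAt_comp_pol_left (hH 1) t θ).const_mul _))
  have hFc : ∀ t, Continuous fun θ => exp t * (cos θ * H 0 (pol t θ) + sin θ * H 1 (pol t θ)) := by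
    intro t
    have a1 := fun i => (hc i).comp (hpolr t)
    simp only [Function.comp_def] at a1
    fun_prop
  obtain ⟨C, hC⟩ := ((isCompact_Icc (a := t - 1) (b := t + 1)).prod
    (isCompact_Icc (a := (0 : ℝ)) (b := 2 * π))).exists_bound_of_continuousOn hF'c.continuousOn
  have hmain := (intervalIntegral.hasDerivAt_integral_of_dominated_loc_of_deriv_le
    (μ := volume) (a := 0) (b := 2 * π) (bound := fun _ => C) (x₀ := t)
    (F := fun t θ => exp t * (cos θ * H 0 (pol t θ) + sin θ * H 1 (pol t θ))) (F' := F')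
    (Icc_mem_nhds (a := t - 1) (b := t + 1) (by linarith) (by linarith))
    (Filter.Eventually.of_forall fun t => (hFc t).aestronglyMeasurable)
    ((hFc t).intervalIntegrable _ _)
    (hF'c.comp (Continuous.prodMk_right t)).aestronglyMeasurable
    (Filter.Eventually.of_forall fun θ hθ s hs => by
      rw [Set.uIoc_of_le (by positivity)] at hθ
      exact hC (s, θ) ⟨hs, hθ.1.le, hθ.2⟩)
    (by simp)
    (Filter.Eventually.of_forall fun θ _ s _ => hF s θ)).2
  have hΨ : ∀ θ, HasDerivAt (fun θ => exp t * (cos θ * H 1 (pol t θ) - sin θ * H 0 (pol t θ)))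
      (exp t ^ 2 * (pderiv (H 0) 0 (pol t θ) + pderiv (H 1) 1 (pol t θ)) - F' t θ) θ := fun θ => by
    refine ((((Real.hasDerivAt_cos θ).mul (hasDerivAt_comp_pol_right (hH 1) t θ)).sub
      ((Real.hasDerivAt_sin θ).mul (hasDerivAt_comp_pol_right (hH 0) t θ))).const_mul
        (exp t)).congr_deriv ?_
    simp only [F']
    linear_combination ((exp t ^ 2 * (pderiv (H 0) 0 (pol t θ) + pderiv (H 1) 1 (pol t θ)))) *
      Real.sin_sq_add_cos_sq θ
  have i1 : IntervalIntegrable (fun θ => exp t ^ 2 *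
      (pderiv (H 0) 0 (pol t θ) + pderiv (H 1) 1 (pol t θ))) volume 0 (2 * π) := by
    have a2 := fun i j => (hpd i j).comp (hpolr t)
    simp only [Function.comp_def] at a2
    exact Continuous.intervalIntegrable (by fun_prop) _ _
  have i2 : IntervalIntegrable (F' t) volume 0 (2 * π) :=
    (hF'c.comp (Continuous.prodMk_right t)).intervalIntegrable _ _
  have e := intervalIntegral.integral_eq_sub_of_hasDerivAt (fun θ _ => hΨ θ) (i1.sub i2)
  rw [intervalIntegral.integral_sub i1 i2, (pol_periodic t).eq] at e
  simp only [cos_two_pi, sin_two_pi, cos_zero, sin_zero, sub_self] at e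
  rw [sub_eq_zero.1 e]
  exact hmain

/-- The data attached to one graph: `v` is a squared truncated height, `A` the conductivity and
`H` the vector field `v A ∇v / 2`. The decay of the gradient enters through `lower` and `grad`. -/
structure Phase (v A : E2 → ℝ) (H : Fin 2 → E2 → ℝ) (R : ℝ) : Prop where
  contDiff : ContDiff ℝ 1 v
  contDiff_field : ∀ i, ContDiff ℝ 1 (H i)
  nonneg : ∀ x, 0 ≤ v x
  field_eq : ∀ i x, H i x = v x * A x * pderiv v i x / 2
  div_eq : ∀ x, pderiv (H 0) 0 x + pderiv (H 1) 1 x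
    = 3 / 4 * A x * (pderiv v 0 x ^ 2 + pderiv v 1 x ^ 2)
  pos : ∀ x, 0 < A x
  le_one : ∀ x, A x ≤ 1
  lower : ∀ x, R ≤ ‖x‖ → 99 / 100 ≤ A x
  grad : ∀ x, R ≤ ‖x‖ → pderiv v 0 x ^ 2 + pderiv v 1 x ^ 2 ≤ v x

/-- The derivative of `flux H`. -/
def fluxDeriv (H : Fin 2 → E2 → ℝ) (t : ℝ) : ℝ :=
  ∫ θ in 0..2 * π, exp t ^ 2 * (pderiv (H 0) 0 (pol t θ) + pderiv (H 1) 1 (pol t θ))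

namespace Phase

variable {v A : E2 → ℝ} {H : Fin 2 → E2 → ℝ} {R : ℝ}

theorem continuous_div (h : Phase v A H R) (t : ℝ) : Continuous fun θ =>
    exp t ^ 2 * (pderiv (H 0) 0 (pol t θ) + pderiv (H 1) 1 (pol t θ)) := by
  have a := fun i j => (continuous_pderiv (h.contDiff_field i) j).comp (continuous_pol_right t)
  simp only [Function.comp_def] at a
  fun_prop

theorem div_nonneg (h : Phase v A H R) (x : E2) :
    0 ≤ pderiv (H 0) 0 x + pderiv (H 1) 1 x := by
  rw [h.div_eq]
  have := h.pos x
  positivity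

theorem fluxDeriv_nonneg (h : Phase v A H R) (t : ℝ) : 0 ≤ fluxDeriv H t :=
  intervalIntegral.integral_nonneg (by positivity) fun θ _ =>
    mul_nonneg (by positivity) (h.div_nonneg _)

theorem hasDerivAt_flux (h : Phase v A H R) (t : ℝ) : HasDerivAt (flux H) (fluxDeriv H t) t :=
  _root_.hasDerivAt_flux h.contDiff_field t

theorem monotone_flux (h : Phase v A H R) : Monotone (flux H) :=
  monotone_of_hasDerivAt_nonneg h.hasDerivAt_flux h.fluxDeriv_nonneg

theorem tendsto_flux_atBot (h : Phase v A H R) :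
    Filter.Tendsto (flux H) Filter.atBot (nhds 0) := by
  have hb : ∀ i, ∃ C, ∀ x ∈ Metric.closedBall (0 : E2) 1, ‖H i x‖ ≤ C := fun i =>
    (isCompact_closedBall (0 : E2) 1).exists_bound_of_continuousOn
      (h.contDiff_field i).continuous.continuousOn
  choose C hC using hb
  have hlim : Filter.Tendsto (fun t => exp t * (C 0 + C 1) * |2 * π - 0|) Filter.atBot
      (nhds 0) := by
    simpa using (Real.tendsto_exp_atBot.mul_const (C 0 + C 1)).mul_const |2 * π - 0|
  refine squeeze_zero_norm' ?_ hlim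
  filter_upwards [Filter.eventually_le_atBot 0] with t ht
  refine intervalIntegral.norm_integral_le_of_norm_le_const fun θ _ => ?_
  have hm : pol t θ ∈ Metric.closedBall (0 : E2) 1 := by
    simpa [norm_pol] using ht
  have b0 := hC 0 _ hm
  have b1 := hC 1 _ hm
  rw [norm_mul, Real.norm_eq_abs, abs_of_pos (exp_pos t)]
  refine mul_le_mul_of_nonneg_left ((norm_add_le _ _).trans (add_le_add ?_ ?_)) (exp_pos t).le
  · rw [norm_mul]
    exact (mul_le_of_le_one_left (norm_nonneg _) (abs_cos_le_one θ)).trans b0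
  · rw [norm_mul]
    exact (mul_le_of_le_one_left (norm_nonneg _) (abs_sin_le_one θ)).trans b1

theorem flux_nonneg (h : Phase v A H R) (t : ℝ) : 0 ≤ flux H t :=
  h.monotone_flux.le_of_tendsto h.tendsto_flux_atBot t

theorem eq_const_of_flux_eq_zero (h : Phase v A H R) (h0 : ∀ t, flux H t = 0) (x y : E2) :
    v x = v y := by
  have hD : ∀ t, fluxDeriv H t = 0 := fun t =>
    (h.hasDerivAt_flux t).unique (by rw [show flux H = fun _ => 0 from funext h0]
                                     exact hasDerivAt_const t 0)
  have hz : ∀ x : E2, x ≠ 0 → pderiv v 0 x ^ 2 + pderiv v 1 x ^ 2 = 0 := by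
    intro x hx
    obtain ⟨t, θ, rfl⟩ := exists_pol_eq hx
    obtain ⟨φ, hφ, e⟩ := (pol_periodic t).exists_mem_Ico₀ two_pi_pos θ
    rw [e]
    have hzero : 0 = exp t ^ 2 *
        (pderiv (H 0) 0 (pol t φ) + pderiv (H 1) 1 (pol t φ)) := by
      by_contra hne
      have hpos := intervalIntegral.integral_pos two_pi_pos (h.continuous_div t).continuousOn
        (fun θ _ => mul_nonneg (by positivity) (h.div_nonneg _))
        ⟨φ, ⟨hφ.1, hφ.2.le⟩, lt_of_le_of_ne (mul_nonneg (by positivity) (h.div_nonneg _)) hne⟩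
      exact hpos.ne' (hD t)
    rw [h.div_eq] at hzero
    have := h.pos (pol t φ)
    have := exp_pos t
    have h4 : exp t ^ 2 * (3 / 4 * A (pol t φ)) ≠ 0 := by positivity
    rw [← mul_assoc] at hzero
    exact (mul_eq_zero.1 hzero.symm).resolve_left h4
  have hc0 := continuous_pderiv h.contDiff 0
  have hc1 := continuous_pderiv h.contDiff 1
  have hz' : (fun x => pderiv v 0 x ^ 2 + pderiv v 1 x ^ 2) = fun _ => 0 :=
    Continuous.ext_on (dense_compl_singleton (0 : E2)) (by fun_prop) continuous_const
      fun x hx => hz x hx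
  refine is_const_of_fderiv_eq_zero (𝕜 := ℝ) (h.contDiff.differentiable one_ne_zero)
    (fun x => ?_) x y
  have hx := congrFun hz' x
  have p0 : pderiv v 0 x = 0 := by nlinarith [sq_nonneg (pderiv v 0 x), sq_nonneg (pderiv v 1 x)]
  have p1 : pderiv v 1 x = 0 := by nlinarith [sq_nonneg (pderiv v 0 x), sq_nonneg (pderiv v 1 x)]
  ext w
  by_cases hw : w = 0
  · simp [hw]
  · obtain ⟨t, θ, rfl⟩ := exists_pol_eq hw
    rw [fderiv_pol, p0, p1]
    simp

/-- The radial derivative of `v` in logarithmic polar coordinates. -/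
def radial (v : E2 → ℝ) (t θ : ℝ) : ℝ :=
  exp t * (cos θ * pderiv v 0 (pol t θ) + sin θ * pderiv v 1 (pol t θ))

/-- The angular derivative of `v` in logarithmic polar coordinates. -/
def angular (v : E2 → ℝ) (t θ : ℝ) : ℝ :=
  exp t * (cos θ * pderiv v 1 (pol t θ) - sin θ * pderiv v 0 (pol t θ))

theorem angular_sq_add_radial_sq (v : E2 → ℝ) (t θ : ℝ) : angular v t θ ^ 2 + radial v t θ ^ 2
    = exp t ^ 2 * (pderiv v 0 (pol t θ) ^ 2 + pderiv v 1 (pol t θ) ^ 2) := by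
  simp only [angular, radial]
  linear_combination (exp t ^ 2 * (pderiv v 0 (pol t θ) ^ 2 + pderiv v 1 (pol t θ) ^ 2)) *
    Real.sin_sq_add_cos_sq θ

theorem continuous_angular (h : Phase v A H R) (t : ℝ) : Continuous (angular v t) := by
  have a := fun j => (continuous_pderiv h.contDiff j).comp (continuous_pol_right t)
  simp only [Function.comp_def] at a
  unfold angular
  fun_prop

theorem continuous_radial (h : Phase v A H R) (t : ℝ) : Continuous (radial v t) := by
  have a := fun j => (continuous_pderiv h.contDiff j).comp (continuous_pol_right t)
  simp only [Function.comp_def] at a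
  unfold radial
  fun_prop

theorem continuous_comp_pol (h : Phase v A H R) (t : ℝ) : Continuous fun θ => v (pol t θ) :=
  h.contDiff.continuous.comp (continuous_pol_right t)

theorem flux_le (h : Phase v A H R) (t : ℝ) :
    flux H t ≤ (∫ θ in 0..2 * π, v (pol t θ) * |radial v t θ|) / 2 := by
  rw [← intervalIntegral.integral_div]
  have hcH := fun j => (h.contDiff_field j).continuous
  have hcv := h.contDiff.continuous
  have hcp := continuous_pol_right t
  have hcr := h.continuous_radial t
  refine intervalIntegral.integral_mono_on (by positivity)
    (Continuous.intervalIntegrable (by fun_prop) _ _)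
    (Continuous.intervalIntegrable (by fun_prop) _ _) fun θ _ => ?_
  have e : exp t * (cos θ * H 0 (pol t θ) + sin θ * H 1 (pol t θ))
      = v (pol t θ) * (A (pol t θ) * radial v t θ) / 2 := by
    rw [h.field_eq, h.field_eq, radial]
    ring
  rw [e]
  have h1 : A (pol t θ) * radial v t θ ≤ |radial v t θ| :=
    (le_abs_self _).trans (by
      rw [abs_mul, abs_of_pos (h.pos _)]
      exact mul_le_of_le_one_left (abs_nonneg _) (h.le_one _))
  have := mul_le_mul_of_nonneg_left h1 (h.nonneg (pol t θ))
  linarith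

theorem flux_le_mul_fluxDeriv (h : Phase v A H R) {t : ℝ} (ht : R ≤ exp t) {a : ℝ}
    (ha : v (pol t a) = 0) :
    8.4 * flux H t ≤ (∫ θ in 0..2 * π, posInd (fun θ => v (pol t θ)) θ) * fluxDeriv H t := by
  set L := ∫ θ in 0..2 * π, posInd (fun θ => v (pol t θ)) θ with hLdef
  have hL : 0 ≤ L := intervalIntegral.integral_nonneg (by positivity) fun y _ => posInd_nonneg _ y
  have hcv := h.contDiff.continuous
  have hcp := continuous_pol_right t
  have hca := h.continuous_angular t
  have hcr := h.continuous_radial t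
  have hper := pol_periodic t
  have hw := wirtinger_periodic (f := fun θ => v (pol t θ)) (f' := angular v t)
    (hasDerivAt_comp_pol_right h.contDiff t) hca (fun θ => h.nonneg _) two_pi_pos.le
    (fun θ => by simp only [hper θ])
    (fun θ => by simp only [angular, hper θ, cos_add_two_pi, sin_add_two_pi]) ha
  rw [← hLdef] at hw
  have hcs := sq_integral_mul_le (f := fun θ => v (pol t θ)) (g := fun θ => |radial v t θ|)
    two_pi_pos.le (Continuous.intervalIntegrable (by fun_prop) _ _)
    (Continuous.intervalIntegrable (by fun_prop) _ _)
    (Continuous.intervalIntegrable (by fun_prop) _ _)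
  simp only [sq_abs] at hcs
  have hfl := h.flux_le t
  have hf0 := h.flux_nonneg t
  set I := ∫ θ in 0..2 * π, v (pol t θ) * |radial v t θ|
  set V := ∫ θ in 0..2 * π, v (pol t θ) ^ 2
  set X := ∫ θ in 0..2 * π, angular v t θ ^ 2 with hX
  set Y := ∫ θ in 0..2 * π, radial v t θ ^ 2 with hY
  have hX0 : 0 ≤ X := intervalIntegral.integral_nonneg (by positivity) fun y _ => sq_nonneg _
  have hY0 : 0 ≤ Y := intervalIntegral.integral_nonneg (by positivity) fun y _ => sq_nonneg _
  have hXY : 297 / 400 * (X + Y) ≤ fluxDeriv H t := by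
    rw [hX, hY, ← intervalIntegral.integral_add (Continuous.intervalIntegrable (by fun_prop) _ _)
      (Continuous.intervalIntegrable (by fun_prop) _ _), ← intervalIntegral.integral_const_mul]
    refine intervalIntegral.integral_mono_on (by positivity)
      (Continuous.intervalIntegrable (by fun_prop) _ _)
      ((h.continuous_div t).intervalIntegrable _ _) fun θ _ => ?_
    rw [angular_sq_add_radial_sq, h.div_eq]
    have hA := h.lower (pol t θ) (by rwa [norm_pol])
    have hp : 0 ≤ exp t ^ 2 * (pderiv v 0 (pol t θ) ^ 2 + pderiv v 1 (pol t θ) ^ 2) := by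
      positivity
    nlinarith
  have hD := h.fluxDeriv_nonneg t
  have h1 : I ^ 2 ≤ L ^ 2 / 8 * (X * Y) := by
    calc I ^ 2 ≤ V * Y := hcs
      _ ≤ (L ^ 2 / 8 * X) * Y := mul_le_mul_of_nonneg_right hw hY0
      _ = _ := by ring
  have h2 : L ^ 2 * (X * Y) ≤ L ^ 2 * ((X + Y) ^ 2 / 4) :=
    mul_le_mul_of_nonneg_left (by nlinarith [sq_nonneg (X - Y)]) (sq_nonneg L)
  have h3 : (297 / 400 * (X + Y)) ^ 2 ≤ fluxDeriv H t ^ 2 :=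
    pow_le_pow_left₀ (by positivity) hXY 2
  have h4 : flux H t ^ 2 ≤ (I / 2) ^ 2 := pow_le_pow_left₀ hf0 hfl 2
  have h5 := mul_le_mul_of_nonneg_left h3 (sq_nonneg L)
  refine le_of_sq_le_sq ?_ (by positivity)
  rw [mul_pow, mul_pow]
  nlinarith [sq_nonneg (flux H t)]

theorem flux_le_exp (h : Phase v A H R) {t : ℝ} (ht : R ≤ exp t) {a : ℝ}
    (ha : v (pol t a) = 0) : flux H t ≤ 1000 * exp (4 * t) := by
  have hcv := h.continuous_comp_pol t
  have hper := pol_periodic t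
  have hE := exp_pos t
  obtain ⟨c, hc, hmax⟩ := isCompact_Icc.exists_isMaxOn (Set.nonempty_Icc.2 two_pi_pos.le)
    hcv.continuousOn
  have hmax' : ∀ θ, v (pol t θ) ≤ v (pol t c) := by
    intro θ
    obtain ⟨φ, hφ, e⟩ := hper.exists_mem_Ico₀ two_pi_pos θ
    rw [e]
    exact hmax ⟨hφ.1, hφ.2.le⟩
  obtain ⟨b, hb, hbe⟩ := hper.exists_mem_Ico₀ two_pi_pos a
  rw [hbe] at ha
  set M := v (pol t c)
  have hM : 0 ≤ M := h.nonneg _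
  have hgrad : ∀ θ, angular v t θ ^ 2 + radial v t θ ^ 2 ≤ (exp t * √M) ^ 2 := by
    intro θ
    rw [angular_sq_add_radial_sq, mul_pow, Real.sq_sqrt hM]
    exact mul_le_mul_of_nonneg_left ((h.grad _ (by rwa [norm_pol])).trans (hmax' θ)) (by positivity)
  have hang : ∀ θ, |angular v t θ| ≤ exp t * √M := fun θ =>
    abs_le_of_sq_le_sq (by nlinarith [hgrad θ, sq_nonneg (radial v t θ)]) (by positivity)
  have hrad : ∀ θ, |radial v t θ| ≤ exp t * √M := fun θ =>
    abs_le_of_sq_le_sq (by nlinarith [hgrad θ, sq_nonneg (angular v t θ)]) (by positivity)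
  have hmv := Convex.norm_image_sub_le_of_norm_hasDerivWithin_le (s := Set.univ)
    (f := fun θ => v (pol t θ)) (f' := angular v t) (C := exp t * √M) (x := b) (y := c)
    (fun θ _ => (hasDerivAt_comp_pol_right h.contDiff t θ).hasDerivWithinAt)
    (fun θ _ => hang θ) convex_univ trivial trivial
  have hbc : ‖c - b‖ ≤ 2 * π := by
    rw [Real.norm_eq_abs, abs_le]
    constructor <;> linarith [hb.1, hb.2, hc.1, hc.2]
  have hpi := pi_lt_d2
  have hpi0 := pi_pos
  have hs0 := Real.sqrt_nonneg M
  have hsM : √M ≤ 6.3 * exp t := by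
    have h1 : M ≤ exp t * √M * (2 * π) := by
      have h2 : M ≤ ‖v (pol t c) - v (pol t b)‖ := by
        rw [ha, sub_zero]; exact le_abs_self _
      exact h2.trans (hmv.trans (mul_le_mul_of_nonneg_left hbc (by positivity)))
    rcases hs0.eq_or_lt with h0 | h0
    · rw [← h0]; positivity
    · refine le_of_mul_le_mul_left ?_ h0
      rw [Real.mul_self_sqrt hM]
      have : 0 ≤ exp t * √M := by positivity
      nlinarith
  have hI : ∫ θ in 0..2 * π, v (pol t θ) * |radial v t θ|
      ≤ ∫ θ in 0..2 * π, M * (exp t * √M) := by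
    have hcv := h.contDiff.continuous
    have hcp := continuous_pol_right t
    have hcr := h.continuous_radial t
    exact intervalIntegral.integral_mono_on (by positivity)
      (Continuous.intervalIntegrable (by fun_prop) _ _) (by simp) fun θ _ =>
      mul_le_mul (hmax' θ) (hrad θ) (abs_nonneg _) hM
  rw [intervalIntegral.integral_const, smul_eq_mul, sub_zero] at hI
  have hfl := h.flux_le t
  have hexp : exp (4 * t) = exp t ^ 4 := by
    rw [← Real.exp_nat_mul]; norm_num
  have hM3 : M * (exp t * √M) ≤ 251 * exp t ^ 4 := by
    have e : M * (exp t * √M) = exp t * √M ^ 3 := by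
      nth_rewrite 1 [← Real.sq_sqrt hM]; ring
    rw [e]
    have := pow_le_pow_left₀ hs0 hsM 3
    have := mul_le_mul_of_nonneg_left this hE.le
    have : 0 < exp t ^ 4 := by positivity
    nlinarith
  rw [hexp]
  have hM3' := mul_le_mul_of_nonneg_left hM3 two_pi_pos.le
  have : 0 < exp t ^ 4 := by positivity
  nlinarith

end Phase

theorem nine_div_le_sum_inv {a b c s : ℝ} (ha : 0 < a) (hb : 0 < b) (hc : 0 < c)
    (h : a + b + c ≤ s) : 9 / s ≤ a⁻¹ + b⁻¹ + c⁻¹ := by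
  have hs : 0 < s := by linarith
  have tangent : ∀ x : ℝ, 0 < x → 6 / s - 9 * x / s ^ 2 ≤ x⁻¹ := by
    intro x hx
    have e : x⁻¹ - (6 / s - 9 * x / s ^ 2) = (s - 3 * x) ^ 2 / (x * s ^ 2) := by
      field_simp
      ring
    have : 0 ≤ (s - 3 * x) ^ 2 / (x * s ^ 2) := by positivity
    linarith
  have hsum : 9 / s ≤ 3 * (6 / s) - 9 * (a + b + c) / s ^ 2 := by
    have e : 3 * (6 / s) - 9 * (a + b + c) / s ^ 2 - 9 / s = 9 * (s - (a + b + c)) / s ^ 2 := by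
      field_simp
      ring
    have : 0 ≤ 9 * (s - (a + b + c)) / s ^ 2 := by
      have : 0 ≤ s - (a + b + c) := by linarith
      positivity
    linarith
  have e : 9 * (a + b + c) / s ^ 2 = 9 * a / s ^ 2 + 9 * b / s ^ 2 + 9 * c / s ^ 2 := by ring
  linarith [tangent a ha, tangent b hb, tangent c hc]

theorem exists_flux_eq_zero_of_three_phases {v A : Fin 3 → E2 → ℝ} {H : Fin 3 → Fin 2 → E2 → ℝ}
    {R : Fin 3 → ℝ} (h : ∀ i, Phase (v i) (A i) (H i) (R i))
    (hdisj : ∀ i j, i ≠ j → ∀ x, 0 < v i x → v j x = 0) :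
    ∃ i, ∀ t, flux (H i) t = 0 := by
  by_contra! hne
  choose τ hτ using hne
  obtain ⟨T, hTτ, hTR⟩ : ∃ T, (∀ i, τ i ≤ T) ∧ ∀ i, R i ≤ exp T := by
    have h1 : ∀ i, ∀ᶠ T in Filter.atTop, τ i ≤ T := fun i => Filter.eventually_ge_atTop _
    have h2 : ∀ i, ∀ᶠ T in Filter.atTop, R i ≤ exp T := fun i =>
      Real.tendsto_exp_atTop.eventually_ge_atTop _
    exact ((Filter.eventually_all.2 h1).and (Filter.eventually_all.2 h2)).exists
  have hR : ∀ i t, T ≤ t → R i ≤ exp t := fun i t ht => (hTR i).trans (exp_le_exp.2 ht)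
  have hpos : ∀ i t, T ≤ t → 0 < flux (H i) t := fun i t ht =>
    (lt_of_le_of_ne ((h i).flux_nonneg _) (hτ i).symm).trans_le
      ((h i).monotone_flux ((hTτ i).trans ht))
  have hzero : ∀ i t, T ≤ t → ∃ a, v i (pol t a) = 0 := by
    intro i t ht
    by_contra! hv
    obtain ⟨j, hj⟩ := exists_ne i
    have hvj : ∀ θ, v j (pol t θ) = 0 := fun θ =>
      hdisj i j hj.symm _ (lt_of_le_of_ne ((h i).nonneg _) (hv θ).symm)
    have := hpos j t ht
    simp [flux, (h j).field_eq, hvj] at this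
  let L : Fin 3 → ℝ → ℝ := fun i t => ∫ θ in 0..2 * π, posInd (fun θ => v i (pol t θ)) θ
  have hii : ∀ i t, IntervalIntegrable (posInd (fun θ => v i (pol t θ))) volume 0 (2 * π) :=
    fun i t => intervalIntegrable_posInd ((h i).continuous_comp_pol t) _ _
  have hLsum : ∀ t, L 0 t + L 1 t + L 2 t ≤ 2 * π := by
    intro t
    simp only [L]
    rw [← intervalIntegral.integral_add (hii 0 t) (hii 1 t),
      ← intervalIntegral.integral_add ((hii 0 t).add (hii 1 t)) (hii 2 t)]
    have hle : ∀ θ, posInd (fun θ => v 0 (pol t θ)) θ + posInd (fun θ => v 1 (pol t θ)) θ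
        + posInd (fun θ => v 2 (pol t θ)) θ ≤ 1 := by
      intro θ
      have key : ∀ i j, i ≠ j → posInd (fun θ => v i (pol t θ)) θ = 1 →
          posInd (fun θ => v j (pol t θ)) θ = 0 := by
        intro i j hij hi
        have hvi : 0 < v i (pol t θ) := by
          by_contra hn
          rw [posInd_of_not_pos hn] at hi
          exact zero_ne_one hi
        exact posInd_of_not_pos (hdisj i j hij _ hvi).not_gt
      have alt : ∀ i, posInd (fun θ => v i (pol t θ)) θ = 0 ∨
          posInd (fun θ => v i (pol t θ)) θ = 1 := by
        intro i
        by_cases hi : 0 < v i (pol t θ)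
        · exact Or.inr (posInd_of_pos hi)
        · exact Or.inl (posInd_of_not_pos hi)
      have k01 := key 0 1 (by decide)
      have k02 := key 0 2 (by decide)
      have k12 := key 1 2 (by decide)
      rcases alt 0 with h0 | h0
      · rcases alt 1 with h1 | h1
        · rcases alt 2 with h2 | h2 <;> simp [h0, h1, h2]
        · simp [h0, h1, k12 h1]
      · simp [h0, k01 h0, k02 h0]
    have := intervalIntegral.integral_mono_on two_pi_pos.le
      (((hii 0 t).add (hii 1 t)).add (hii 2 t)) (intervalIntegrable_const (c := (1 : ℝ)))
      fun θ _ => hle θ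
    simpa using this
  have hgrowth : ∀ i t, T ≤ t →
      0 < L i t ∧ 8.4 * (L i t)⁻¹ ≤ fluxDeriv (H i) t / flux (H i) t := by
    intro i t ht
    obtain ⟨a, ha⟩ := hzero i t ht
    have hf := hpos i t ht
    have hle := (h i).flux_le_mul_fluxDeriv (hR i t ht) ha
    have hL : 0 < L i t := by
      by_contra hn
      have := mul_nonpos_of_nonpos_of_nonneg (not_lt.1 hn) ((h i).fluxDeriv_nonneg t)
      linarith
    refine ⟨hL, ?_⟩
    rw [le_div_iff₀ hf, mul_right_comm, ← div_eq_mul_inv, div_le_iff₀ hL, mul_comm _ (L i t)]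
    exact hle
  let G : ℝ → ℝ := fun t =>
    Real.log (flux (H 0) t) + Real.log (flux (H 1) t) + Real.log (flux (H 2) t) - 12.03 * t
  have hG : ∀ t, T ≤ t → HasDerivAt G (fluxDeriv (H 0) t / flux (H 0) t
      + fluxDeriv (H 1) t / flux (H 1) t + fluxDeriv (H 2) t / flux (H 2) t - 12.03) t := by
    intro t ht
    have hl := fun i => ((h i).hasDerivAt_flux t).log (hpos i t ht).ne'
    exact ((((hl 0).add (hl 1)).add (hl 2)).sub
      ((hasDerivAt_id t).const_mul 12.03)).congr_deriv (by simp)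
  have hmono : MonotoneOn G (Set.Ici T) := by
    refine monotoneOn_of_hasDerivWithinAt_nonneg (convex_Ici T)
      (fun t ht => (hG t ht).continuousAt.continuousWithinAt)
      (fun t ht => (hG t (interior_subset ht)).hasDerivWithinAt) fun t ht => ?_
    have ht' : T ≤ t := interior_subset ht
    obtain ⟨l0, g0⟩ := hgrowth 0 t ht'
    obtain ⟨l1, g1⟩ := hgrowth 1 t ht'
    obtain ⟨l2, g2⟩ := hgrowth 2 t ht'
    have hs := nine_div_le_sum_inv l0 l1 l2 (hLsum t)
    have hpi : 12.03 ≤ 8.4 * (9 / (2 * π)) := by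
      rw [mul_div_assoc', le_div_iff₀ two_pi_pos]
      linarith [pi_lt_d4]
    linarith
  have hupper : ∀ t, T ≤ t → G t ≤ 3 * Real.log 1000 - 0.03 * t := by
    intro t ht
    have hlog : ∀ i, Real.log (flux (H i) t) ≤ Real.log 1000 + 4 * t := by
      intro i
      obtain ⟨a, ha⟩ := hzero i t ht
      have := Real.log_le_log (hpos i t ht) ((h i).flux_le_exp (hR i t ht) ha)
      rwa [Real.log_mul (by norm_num) (exp_pos _).ne', Real.log_exp] at this
    have h0 := hlog 0
    have h1 := hlog 1
    have h2 := hlog 2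
    simp only [G]
    linarith
  set t := max T ((3 * Real.log 1000 - G T + 1) / 0.03)
  have ht : T ≤ t := le_max_left _ _
  have ht2 : (3 * Real.log 1000 - G T + 1) / 0.03 ≤ t := le_max_right _ _
  rw [div_le_iff₀ (by norm_num)] at ht2
  have := hmono (Set.mem_Ici.2 le_rfl) (Set.mem_Ici.2 ht) ht
  have := hupper t ht
  linarith

theorem hasDerivAt_max_zero_pow (n : ℕ) (y : ℝ) :
    HasDerivAt (fun y : ℝ => max y 0 ^ (n + 2)) ((n + 2) * max y 0 ^ (n + 1)) y := by
  rcases lt_trichotomy y 0 with hy | rfl | hy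
  · have e : (fun y : ℝ => max y 0 ^ (n + 2)) =ᶠ[nhds y] fun _ => 0 := by
      filter_upwards [Iio_mem_nhds hy] with z hz
      simp [max_eq_right (Set.mem_Iio.1 hz).le]
    rw [max_eq_right hy.le, zero_pow n.succ_ne_zero, mul_zero]
    exact (hasDerivAt_const y (0 : ℝ)).congr_of_eventuallyEq e
  · rw [max_self, zero_pow n.succ_ne_zero, mul_zero, hasDerivAt_iff_isLittleO]
    have h1 : (fun y : ℝ => max y 0 ^ (n + 2)) =O[nhds 0] fun y : ℝ => y ^ (n + 2) := by
      refine Asymptotics.IsBigO.of_bound 1 (Filter.Eventually.of_forall fun y => ?_)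
      rw [norm_pow, norm_pow, one_mul]
      refine pow_le_pow_left₀ (norm_nonneg _) ?_ _
      rw [Real.norm_eq_abs, Real.norm_eq_abs, abs_of_nonneg (le_max_right y 0)]
      exact max_le (le_abs_self y) (abs_nonneg y)
    have h2 : (fun y : ℝ => y ^ (n + 2)) =o[nhds 0] fun y : ℝ => y := by
      simpa using Asymptotics.isLittleO_pow_id (𝕜 := ℝ) (n := n + 2) (by omega)
    simpa using h1.trans_isLittleO h2
  · have e : (fun y : ℝ => max y 0 ^ (n + 2)) =ᶠ[nhds y] fun y => y ^ (n + 2) := by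
      filter_upwards [Ioi_mem_nhds hy] with z hz
      rw [max_eq_left (Set.mem_Ioi.1 hz).le]
    rw [max_eq_left hy.le]
    refine ((hasDerivAt_pow (n + 2) y).congr_of_eventuallyEq e).congr_deriv ?_
    push_cast
    rfl

theorem contDiff_max_zero_pow (n : ℕ) : ContDiff ℝ 1 fun y : ℝ => max y 0 ^ (n + 2) := by
  rw [contDiff_one_iff_deriv]
  refine ⟨fun y => (hasDerivAt_max_zero_pow n y).differentiableAt, ?_⟩
  rw [show deriv (fun y : ℝ => max y 0 ^ (n + 2)) = fun y : ℝ =>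
      ((n : ℝ) + 2) * max y 0 ^ (n + 1) from
    funext fun y => (hasDerivAt_max_zero_pow n y).deriv]
  fun_prop

theorem gradient_apply (u : E2 → ℝ) (x : E2) (i : Fin 2) : gradient u x i = pderiv u i x := by
  have h := inner_gradient_left (𝕜 := ℝ) (f := u) (x := x) (y := EuclideanSpace.single i 1)
  rw [EuclideanSpace.inner_single_right] at h
  simpa [pderiv] using h

theorem norm_gradient_sq (u : E2 → ℝ) (x : E2) :
    ‖gradient u x‖ ^ 2 = pderiv u 0 x ^ 2 + pderiv u 1 x ^ 2 := by
  rw [EuclideanSpace.norm_sq_eq, Fin.sum_univ_two, gradient_apply, gradient_apply]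
  simp

/-- The `i`-th component of `∇u/√(1+|∇u|²)`. -/
def msField (u : E2 → ℝ) (i : Fin 2) (x : E2) : ℝ :=
  (Real.sqrt (1 + ‖gradient u x‖ ^ 2))⁻¹ * gradient u x i

theorem contDiffAt_msField {u : E2 → ℝ} {x : E2} (hu : ContDiffAt ℝ 2 u x) (i : Fin 2) :
    ContDiffAt ℝ 1 (msField u i) x := by
  have h1 : ContDiffAt ℝ 1 (fderiv ℝ u) x := hu.fderiv_right (by norm_num)
  have hp : ∀ j, ContDiffAt ℝ 1 (pderiv u j) x := fun j => h1.clm_apply contDiffAt_const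
  have e : msField u i = fun x =>
      (Real.sqrt (1 + (pderiv u 0 x ^ 2 + pderiv u 1 x ^ 2)))⁻¹ * pderiv u i x := by
    ext x
    rw [msField, norm_gradient_sq, gradient_apply]
  rw [e]
  have hpos : 0 < 1 + (pderiv u 0 x ^ 2 + pderiv u 1 x ^ 2) := by positivity
  exact (((contDiffAt_const.add (((hp 0).pow 2).add ((hp 1).pow 2))).sqrt hpos.ne').inv
    (Real.sqrt_pos.2 hpos).ne').mul (hp i)

/-- The height of the graph above level `δ`, extended by zero. -/
def excess (Ω : Set E2) (u : E2 → ℝ) (δ : ℝ) : E2 → ℝ := Ω.indicator fun x => max (u x - δ) 0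

section Excess

variable {Ω : Set E2} {u : E2 → ℝ} {δ : ℝ} {x : E2}

theorem excess_nonneg : 0 ≤ excess Ω u δ x :=
  Set.indicator_nonneg (fun _ _ => le_max_right _ _) x

theorem excess_pos_iff : 0 < excess Ω u δ x ↔ x ∈ Ω ∧ δ < u x := by
  by_cases hx : x ∈ Ω
  · simp [excess, hx]
  · simp [excess, hx]

theorem excess_eventuallyEq (hopen : IsOpen Ω) (hx : x ∈ Ω) :
    excess Ω u δ =ᶠ[nhds x] fun x => max (u x - δ) 0 := by
  filter_upwards [hopen.mem_nhds hx] with y hy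
  exact Set.indicator_of_mem hy _

theorem excess_eventuallyEq_zero (hopen : IsOpen Ω) (hcont : ContinuousOn u (closure Ω))
    (hbdry : ∀ x ∈ frontier Ω, u x = 0) (hδ : 0 < δ) (hx : x ∉ Ω) :
    excess Ω u δ =ᶠ[nhds x] fun _ => 0 := by
  by_cases hxc : x ∈ closure Ω
  · have hu0 : u x = 0 := hbdry x (by rw [hopen.frontier_eq]; exact ⟨hxc, hx⟩)
    have hlt : ∀ᶠ y in nhdsWithin x (closure Ω), u y < δ :=
      (hcont x hxc).eventually_lt continuousWithinAt_const (by rwa [hu0])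
    filter_upwards [eventually_nhdsWithin_iff.1 hlt] with y hy
    by_cases hyΩ : y ∈ Ω
    · simp [excess, hyΩ, (hy (subset_closure hyΩ)).le]
    · simp [excess, hyΩ]
  · filter_upwards [isClosed_closure.isOpen_compl.mem_nhds hxc] with y hy
    exact Set.indicator_of_notMem (fun h => hy (subset_closure h)) _

theorem contDiffAt_excess_pow (hopen : IsOpen Ω) (hu : ContDiffAt ℝ 1 u x) (hx : x ∈ Ω) (n : ℕ) :
    ContDiffAt ℝ 1 (fun y => excess Ω u δ y ^ (n + 2)) x :=
  ((contDiff_max_zero_pow n).contDiffAt.comp x (hu.sub contDiffAt_const)).congr_of_eventuallyEq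
    ((excess_eventuallyEq hopen hx).pow_const (n + 2))

theorem pderiv_excess_pow (hopen : IsOpen Ω) (hu : DifferentiableAt ℝ u x) (hx : x ∈ Ω) (n : ℕ)
    (i : Fin 2) : pderiv (fun y => excess Ω u δ y ^ (n + 2)) i x
      = (n + 2) * excess Ω u δ x ^ (n + 1) * pderiv u i x := by
  have h : HasFDerivAt (fun y => excess Ω u δ y ^ (n + 2))
      ((((n : ℝ) + 2) * max (u x - δ) 0 ^ (n + 1)) • fderiv ℝ u x) x :=
    ((hasDerivAt_max_zero_pow n (u x - δ)).comp_hasFDerivAt x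
    (hu.hasFDerivAt.sub_const δ)).congr_of_eventuallyEq
    ((excess_eventuallyEq hopen hx).pow_const (n + 2))
  rw [pderiv, h.fderiv, (excess_eventuallyEq hopen hx).eq_of_nhds]
  rfl

theorem exists_phase (hopen : IsOpen Ω) (hsmooth : ContDiffOn ℝ (⊤ : ℕ∞) u Ω)
    (hmse : ∀ x ∈ Ω, msDiv u x = 0) (hcont : ContinuousOn u (closure Ω))
    (hbdry : ∀ x ∈ frontier Ω, u x = 0)
    (hgrad : ∀ ε > 0, ∃ M : ℝ, ∀ x ∈ Ω, M ≤ ‖x‖ → ‖gradient u x‖ < ε) (hδ : 0 < δ) :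
    ∃ A H R, Phase (fun x => excess Ω u δ x ^ 2) A H R := by
  classical
  obtain ⟨R, hR⟩ := hgrad (1 / 10) (by norm_num)
  have hu : ∀ x ∈ Ω, ContDiffAt ℝ 2 u x := fun x hx =>
    ((hsmooth x hx).contDiffAt (hopen.mem_nhds hx)).of_le (WithTop.coe_le_coe.2 le_top)
  have hud : ∀ x ∈ Ω, DifferentiableAt ℝ u x := fun x hx =>
    (hu x hx).differentiableAt (by norm_num)
  have hout : ∀ x ∉ Ω, excess Ω u δ =ᶠ[nhds x] fun _ => 0 := fun x hx =>
    excess_eventuallyEq_zero hopen hcont hbdry hδ hx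
  have hs0 : ∀ x ∉ Ω, excess Ω u δ x = 0 := fun x hx => (hout x hx).eq_of_nhds
  have hvout : ∀ x ∉ Ω, (fun x => excess Ω u δ x ^ 2) =ᶠ[nhds x] fun _ => 0 := fun x hx => by
    filter_upwards [hout x hx] with y hy
    simp [hy]
  have hHout : ∀ i, ∀ x ∉ Ω,
      (fun x => excess Ω u δ x ^ 3 * msField u i x) =ᶠ[nhds x] fun _ => 0 := fun i x hx => by
    filter_upwards [hout x hx] with y hy
    simp [hy]
  have hpd0 : ∀ {f : E2 → ℝ} {x : E2} (i : Fin 2), f =ᶠ[nhds x] (fun _ => 0) →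
      pderiv f i x = 0 := fun i h => by
    rw [pderiv, h.fderiv_eq]
    simp
  have hpv : ∀ x ∈ Ω, ∀ i, pderiv (fun x => excess Ω u δ x ^ 2) i x
      = 2 * excess Ω u δ x * pderiv u i x := fun x hx i => by
    simpa using pderiv_excess_pow hopen (hud x hx) hx 0 i
  refine ⟨fun x => if x ∈ Ω then (Real.sqrt (1 + ‖gradient u x‖ ^ 2))⁻¹ else 1,
    fun i x => excess Ω u δ x ^ 3 * msField u i x, R, ?_, ?_, ?_, ?_, ?_, ?_, ?_, ?_, ?_⟩
  · rw [contDiff_iff_contDiffAt]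
    intro x
    by_cases hx : x ∈ Ω
    · exact contDiffAt_excess_pow hopen ((hu x hx).of_le (by norm_num)) hx 0
    · exact contDiffAt_const.congr_of_eventuallyEq (hvout x hx)
  · intro i
    rw [contDiff_iff_contDiffAt]
    intro x
    by_cases hx : x ∈ Ω
    · exact (contDiffAt_excess_pow hopen ((hu x hx).of_le (by norm_num)) hx 1).mul
        (contDiffAt_msField (hu x hx) i)
    · exact contDiffAt_const.congr_of_eventuallyEq (hHout i x hx)
  · exact fun x => sq_nonneg _
  · intro i x
    by_cases hx : x ∈ Ω
    · rw [hpv x hx, if_pos hx, msField, gradient_apply]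
      ring
    · simp [hs0 x hx]
  · intro x
    by_cases hx : x ∈ Ω
    · have hp : ∀ i, pderiv (fun x => excess Ω u δ x ^ 3 * msField u i x) i x
          = excess Ω u δ x ^ 3 * pderiv (msField u i) i x
            + msField u i x * (3 * excess Ω u δ x ^ 2 * pderiv u i x) := by
        intro i
        have h3 := pderiv_excess_pow (δ := δ) hopen (hud x hx) hx 1 i
        have hd := (contDiffAt_excess_pow (δ := δ) hopen ((hu x hx).of_le (by norm_num)) hx
          1).differentiableAt one_ne_zero
        rw [pderiv, fderiv_fun_mul hd ((contDiffAt_msField (hu x hx) i).differentiableAt one_ne_zero)]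
        simp only [pderiv, _root_.add_apply, _root_.smul_apply,
          smul_eq_mul] at h3 ⊢
        rw [h3]
        norm_num
      have hm := hmse x hx
      rw [msDiv, Fin.sum_univ_two] at hm
      have hm' : pderiv (msField u 0) 0 x + pderiv (msField u 1) 1 x = 0 := hm
      rw [hp, hp, hpv x hx, hpv x hx, if_pos hx]
      simp only [msField, gradient_apply] at hm' ⊢
      linear_combination excess Ω u δ x ^ 3 * hm'
    · rw [hpd0 0 (hHout 0 x hx), hpd0 1 (hHout 1 x hx), hpd0 0 (hvout x hx), hpd0 1 (hvout x hx)]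
      simp
  · intro x
    split_ifs <;> positivity
  · intro x
    split_ifs
    · exact inv_le_one_of_one_le₀ (Real.one_le_sqrt.2 (by nlinarith [sq_nonneg ‖gradient u x‖]))
    · exact le_rfl
  · intro x hxR
    split_ifs with hx
    · have hg := hR x hx hxR
      have h0 := norm_nonneg (gradient u x)
      have hsq : Real.sqrt (1 + ‖gradient u x‖ ^ 2) ≤ 100 / 99 :=
        Real.sqrt_le_iff.2 ⟨by norm_num, by nlinarith⟩
      rw [le_inv_comm₀ (by norm_num) (by positivity)]
      linarith
    · norm_num
  · intro x hxR
    by_cases hx : x ∈ Ω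
    · have hg := hR x hx hxR
      have h0 := norm_nonneg (gradient u x)
      have hsq : pderiv u 0 x ^ 2 + pderiv u 1 x ^ 2 ≤ 1 / 4 := by
        rw [← norm_gradient_sq]; nlinarith
      rw [hpv x hx, hpv x hx]
      nlinarith [sq_nonneg (excess Ω u δ x)]
    · rw [hpd0 0 (hvout x hx), hpd0 1 (hvout x hx)]
      simp [hs0 x hx]

end Excess

/-- **Meeks' conjecture under gradient decay.** If `(Ω₁,u₁),…,(Ω_k,u_k)` are disjointly
supported minimal graphs in `ℝ³` whose gradients decay at infinity, i.e. `|∇uᵢ(x)| → 0` as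
`|x| → ∞` in `Ωᵢ` for each `i`, then `k ≤ 2`. -/
theorem disjoint_minimal_graphs_gradient_decay
    (k : ℕ) (Ω : Fin k → Set E2) (u : Fin k → E2 → ℝ)
    (hopen : ∀ i, IsOpen (Ω i))
    (hdisj : Pairwise fun i j => Disjoint (Ω i) (Ω j))
    (hsmooth : ∀ i, ContDiffOn ℝ (⊤ : ℕ∞) (u i) (Ω i))
    (hmse : ∀ i, ∀ x ∈ Ω i, msDiv (u i) x = 0)
    (hnonneg : ∀ i, ∀ x ∈ Ω i, 0 ≤ u i x)
    (hcont : ∀ i, ContinuousOn (u i) (closure (Ω i)))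
    (hbdry : ∀ i, ∀ x ∈ frontier (Ω i), u i x = 0)
    (hnontrivial : ∀ i, ∃ x ∈ Ω i, u i x ≠ 0)
    (hgrad : ∀ i, ∀ ε > 0, ∃ M : ℝ, ∀ x ∈ Ω i, M ≤ ‖x‖ → ‖gradient (u i) x‖ < ε) :
    k ≤ 2 := by
  by_contra! hk
  have hk3 : 3 ≤ k := hk
  choose p hpΩ hp0 using hnontrivial
  have hp : ∀ i, 0 < u i (p i) := fun i => lt_of_le_of_ne (hnonneg i _ (hpΩ i)) (hp0 i).symm
  choose A H R hphase using fun i => exists_phase (hopen i) (hsmooth i) (hmse i) (hcont i)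
    (hbdry i) (hgrad i) (half_pos (hp i))
  let ι : Fin 3 → Fin k := Fin.castLE hk3
  have hι : Function.Injective ι := Fin.castLE_injective hk3
  have hmem : ∀ i x, 0 < excess (Ω i) (u i) (u i (p i) / 2) x ^ 2 → x ∈ Ω i := fun i x hx =>
    (excess_pos_iff.1 (lt_of_le_of_ne excess_nonneg (fun h => by rw [← h] at hx; simp at hx))).1
  obtain ⟨i, hi⟩ := exists_flux_eq_zero_of_three_phases (fun i => hphase (ι i))
    fun i j hij x hx => by
      by_contra hne
      have hj := hmem (ι j) x (lt_of_le_of_ne (sq_nonneg _) (Ne.symm hne))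
      exact Set.disjoint_left.1 (hdisj (hι.ne hij)) (hmem (ι i) x hx) hj
  obtain ⟨j, hj⟩ := exists_ne i
  have hconst := (hphase (ι i)).eq_const_of_flux_eq_zero hi (p (ι i)) (p (ι j))
  have hpos : 0 < excess (Ω (ι i)) (u (ι i)) (u (ι i) (p (ι i)) / 2) (p (ι i)) ^ 2 :=
    pow_pos (excess_pos_iff.2 ⟨hpΩ _, half_lt_self (hp _)⟩) 2
  exact Set.disjoint_left.1 (hdisj (hι.ne hj)) (hpΩ (ι j)) (hmem _ _ (hconst ▸ hpos))
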